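/- arXiv:2512.08519 — 2 statements merged into one kernel-verified Lean document; each statement's English description precedes it below -/
import Mathlib

section
/- Let F be a Furstenberg family and let (X,T) be a topological dynamical system where X is not a singleton. Then T is F-mixing if and only if N_T = {A ⊆ ℕ : N(U,V) ⊆ A for some nonempty open subsets U, V of X} is a shift-invariant thick subfamily of F (in particular ∅ ∉ N_T and N_T ⊆ F). -/
open Set Topology Function Filter
open scoped ENNReal

/- ### Basic dynamical notions -/

/-- The return time set `N(U,V) = {n ∈ ℕ : T^n(U) ∩ V ≠ ∅}`. -/
def nset {X : Type*} (T : X → X) (U V : Set X) : Set ℕ :=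
  {n : ℕ | ∃ x ∈ U, T^[n] x ∈ V}

/-- A Furstenberg family: nonempty, hereditary upward, not containing `∅`. -/
def IsFamily (F : Set (Set ℕ)) : Prop :=
  F.Nonempty ∧ (∀ ⦃A B : Set ℕ⦄, A ∈ F → A ⊆ B → B ∈ F) ∧ ∅ ∉ F

/-- `T` is `F`-transitive. -/
def FTrans {X : Type*} [TopologicalSpace X] (T : X → X) (F : Set (Set ℕ)) : Prop :=
  ∀ U V : Set X, IsOpen U → IsOpen V → U.Nonempty → V.Nonempty → nset T U V ∈ F

/-- Direct sum (product) of two maps. -/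
def prodMap' {X Y : Type*} (T : X → X) (S : Y → Y) : X × Y → X × Y :=
  fun p => (T p.1, S p.2)

/-- `T` is `F`-mixing: `T × T` is `F`-transitive. -/
def FMix {X : Type*} [TopologicalSpace X] (T : X → X) (F : Set (Set ℕ)) : Prop :=
  FTrans (prodMap' T T) F

/-- Topological transitivity. -/
def TopTrans {X : Type*} [TopologicalSpace X] (T : X → X) : Prop :=
  ∀ U V : Set X, IsOpen U → IsOpen V → U.Nonempty → V.Nonempty → (nset T U V).Nonempty

/-- Weak mixing: `T × T` is topologically transitive. -/
def WMix {X : Type*} [TopologicalSpace X] (T : X → X) : Prop :=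
  TopTrans (prodMap' T T)

/-- Hypercyclicity: some point has dense orbit. -/
def HypercyclicMap {X : Type*} [TopologicalSpace X] (T : X → X) : Prop :=
  ∃ x : X, Dense (Set.range fun n : ℕ => T^[n] x)

/-- Weak disjointness: the direct sum is hypercyclic. -/
def WeaklyDisjoint {X Y : Type*} [TopologicalSpace X] [TopologicalSpace Y]
    (T : X → X) (S : Y → Y) : Prop :=
  HypercyclicMap (prodMap' T S)

/-- The family generated by the return time sets of `T`. -/
def NTfam {X : Type*} [TopologicalSpace X] (T : X → X) : Set (Set ℕ) :=
  {A : Set ℕ | ∃ U V : Set X, IsOpen U ∧ IsOpen V ∧ U.Nonempty ∧ V.Nonempty ∧ nset T U V ⊆ A}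

/- ### Combinatorial families -/

/-- `(A + i) ∩ ℕ` for `i : ℤ`. -/
def shiftSet (A : Set ℕ) (i : ℤ) : Set ℕ := {n : ℕ | ∃ m ∈ A, (n : ℤ) = (m : ℤ) + i}

/-- A shift-invariant family. -/
def ShiftInvariant (F : Set (Set ℕ)) : Prop := ∀ A ∈ F, ∀ i : ℤ, shiftSet A i ∈ F

/-- A shift₊-invariant family: `A + i ∈ F` for `i : ℕ`. -/
def ShiftPlusInvariant (F : Set (Set ℕ)) : Prop :=
  ∀ A ∈ F, ∀ i : ℕ, (fun n => n + i) '' A ∈ F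

/-- A thick family: `⋂_{i=0}^{k} ((A - i) ∩ ℕ) ∈ F` for all `A ∈ F`, `k ∈ ℕ`. -/
def ThickFamily (F : Set (Set ℕ)) : Prop :=
  ∀ A ∈ F, ∀ k : ℕ, {n : ℕ | ∀ i ≤ k, n + i ∈ A} ∈ F

/-- The dual family `F*`. -/
def dualFam (F : Set (Set ℕ)) : Set (Set ℕ) := {A | ∀ B ∈ F, (A ∩ B).Nonempty}

/-- A full family. -/
def FullFamily (F : Set (Set ℕ)) : Prop :=
  ∀ A ∈ F, ∀ B ∈ dualFam F, (A ∩ B).Infinite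

/-- `F̃`: the members `A` of `F` with `⋂_{i=-k}^{k} ((A + i) ∩ ℕ) ∈ F` for all `k ∈ ℕ`. -/
def tildeFam (F : Set (Set ℕ)) : Set (Set ℕ) :=
  {A ∈ F | ∀ k : ℕ, {n : ℕ | ∀ i : ℤ, |i| ≤ (k : ℤ) → n ∈ shiftSet A i} ∈ F}

/-- A thick subset of `ℕ`: contains arbitrarily long blocks of consecutive integers. -/
def IsThickSet (A : Set ℕ) : Prop := ∀ k : ℕ, ∃ n : ℕ, ∀ i ≤ k, n + i ∈ A

/-- A syndetic subset of `ℕ` (bounded gaps). -/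
def IsSyndetic (A : Set ℕ) : Prop := ∃ g : ℕ, ∀ n : ℕ, ∃ m ∈ A, n ≤ m ∧ m ≤ n + g

/-- A piecewise syndetic subset: intersection of a syndetic and a thick set. -/
def IsPiecewiseSyndetic (A : Set ℕ) : Prop :=
  ∃ S T : Set ℕ, IsSyndetic S ∧ IsThickSet T ∧ A = S ∩ T

/-- An IP-set. -/
def IsIPSet (A : Set ℕ) : Prop :=
  ∃ x : ℕ → ℕ, {n | x n ≠ 0}.Infinite ∧ ∀ s : Finset ℕ, s.Nonempty → (∑ i ∈ s, x i) ∈ A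

/-- `(A - A) ∩ ℕ` for `A ⊆ ℕ`: positive differences of distinct elements. -/
def diffSet (A : Set ℕ) : Set ℕ := {k | ∃ m ∈ A, ∃ n ∈ A, n < m ∧ k = m - n}

/-- The family `Δ*_ip`. -/
def deltaIPStar : Set (Set ℕ) :=
  {A | ∀ F : Set ℕ, IsIPSet F → (A ∩ diffSet F).Nonempty}

/- ### Operators on Fréchet spaces -/

/-- A (continuous linear) operator on an infinite-dimensional separable Fréchet space
(a complete metrizable locally convex topological vector space) over `ℝ` or `ℂ`
(an `RCLike` field). -/
structure FrechetOp where
  𝕜 : Type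
  [instField : RCLike 𝕜]
  X : Type
  [instAdd : AddCommGroup X]
  [instMod : Module 𝕜 X]
  [instUnif : UniformSpace X]
  [instUAG : IsUniformAddGroup X]
  [instSMul : ContinuousSMul 𝕜 X]
  [instComplete : CompleteSpace X]
  [instMetrizable : TopologicalSpace.MetrizableSpace X]
  [instSeparable : TopologicalSpace.SeparableSpace X]
  [instModR : Module ℝ X]
  [instTower : IsScalarTower ℝ 𝕜 X]
  [instLC : LocallyConvexSpace ℝ X]
  infDim : ¬ FiniteDimensional 𝕜 X
  T : X → X
  linear : IsLinearMap 𝕜 T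
  cont : Continuous T

attribute [instance] FrechetOp.instAdd FrechetOp.instMod
  FrechetOp.instUnif FrechetOp.instUAG FrechetOp.instSMul FrechetOp.instComplete
  FrechetOp.instMetrizable FrechetOp.instSeparable FrechetOp.instModR
  FrechetOp.instTower FrechetOp.instLC

/-- A bundled Fréchet-space operator is hypercyclic. -/
def FrechetOp.Hypercyclic (S : FrechetOp) : Prop := HypercyclicMap S.T

/-- A bundled Fréchet-space operator is invertible (a linear homeomorphism). -/
def FrechetOp.Invertible (S : FrechetOp) : Prop :=
  ∃ T' : S.X → S.X, Continuous T' ∧ (∀ x, T' (S.T x) = x) ∧ (∀ x, S.T (T' x) = x)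

/-- Mild mixing: weakly disjoint from every hypercyclic operator
(on every infinite-dimensional separable Fréchet space). -/
def MildlyMixing {X : Type*} [TopologicalSpace X] (T : X → X) : Prop :=
  ∀ S : FrechetOp, S.Hypercyclic → WeaklyDisjoint T S.T

/-- Topological ergodicity: all return time sets are syndetic. -/
def TopErgodic {X : Type*} [TopologicalSpace X] (T : X → X) : Prop :=
  ∀ U V : Set X, IsOpen U → IsOpen V → U.Nonempty → V.Nonempty → IsSyndetic (nset T U V)

/-- The `F`-Mixing Criterion for a map `T`. -/
def FMixCriterion {X : Type*} [TopologicalSpace X] [Zero X] (T : X → X)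
    (F : Set (Set ℕ)) : Prop :=
  ∃ X₀ Y₀ : Set X, Dense X₀ ∧ Dense Y₀ ∧ ∃ S : ℕ → X → X,
    ∀ x₀ ∈ X₀, ∀ y₀ ∈ Y₀, ∀ O ∈ nhds ((0, 0, y₀) : X × X × X),
      {n : ℕ | (T^[n] x₀, S n y₀, T^[n] (S n y₀)) ∈ O} ∈ F

/- ### Bilateral weighted backward shifts on `ℓᵖ(ℤ)` and `c₀(ℤ)` -/

/-- `B` is the bilateral weighted backward shift with (positive, bounded) weight `w` on
`ℓᵖ(ℤ)`; the condition that `1/w` is bounded makes it invertible. -/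
def IsInvertibleWBSlp (𝕜 : Type) [RCLike 𝕜] (p : ℝ≥0∞) [Fact (1 ≤ p)] (w : ℤ → ℝ)
    (B : lp (fun _ : ℤ => 𝕜) p →L[𝕜] lp (fun _ : ℤ => 𝕜) p) : Prop :=
  (∀ n, 0 < w n) ∧ (∃ C : ℝ, ∀ n, w n ≤ C) ∧ (∃ c : ℝ, 0 < c ∧ ∀ n, c ≤ w n) ∧
    ∀ (x : lp (fun _ : ℤ => 𝕜) p) (n : ℤ), B x n = w (n + 1) • x (n + 1)

/-- `B` is the bilateral weighted backward shift with (positive, bounded) weight `w` on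
`c₀(ℤ)`; the condition that `1/w` is bounded makes it invertible. -/
def IsInvertibleWBSc0 (𝕜 : Type) [RCLike 𝕜] (w : ℤ → ℝ)
    (B : ZeroAtInftyContinuousMap ℤ 𝕜 →L[𝕜] ZeroAtInftyContinuousMap ℤ 𝕜) : Prop :=
  (∀ n, 0 < w n) ∧ (∃ C : ℝ, ∀ n, w n ≤ C) ∧ (∃ c : ℝ, 0 < c ∧ ∀ n, c ≤ w n) ∧
    ∀ (x : ZeroAtInftyContinuousMap ℤ 𝕜) (n : ℤ), B x n = w (n + 1) • x (n + 1)

theorem nset_mono' {X : Type*} {T : X → X} {U U' V V' : Set X} (hU : U ⊆ U') (hV : V ⊆ V') :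
    nset T U V ⊆ nset T U' V' := by
  rintro n ⟨x, hx, hy⟩
  exact ⟨x, hU hx, hV hy⟩

theorem prod_iter' {X : Type*} (T : X → X) (n : ℕ) (p : X × X) :
    (prodMap' T T)^[n] p = (T^[n] p.1, T^[n] p.2) := by
  induction n generalizing p with
  | zero => rfl
  | succ n ih => rw [iterate_succ_apply, ih]; rfl

theorem nset_prod' {X : Type*} (T : X → X) (U₁ U₂ V₁ V₂ : Set X) :
    nset (prodMap' T T) (U₁ ×ˢ U₂) (V₁ ×ˢ V₂) = nset T U₁ V₁ ∩ nset T U₂ V₂ := by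
  ext n
  constructor
  · rintro ⟨p, hp, hq⟩
    rw [prod_iter'] at hq
    exact ⟨⟨p.1, hp.1, hq.1⟩, ⟨p.2, hp.2, hq.2⟩⟩
  · rintro ⟨⟨x, hx, hx'⟩, ⟨y, hy, hy'⟩⟩
    refine ⟨(x, y), ⟨hx, hy⟩, ?_⟩
    rw [prod_iter']
    exact ⟨hx', hy'⟩

def WM2 {X : Type*} [TopologicalSpace X] (T : X → X) : Prop :=
  ∀ U₁ V₁ U₂ V₂ : Set X, IsOpen U₁ → IsOpen V₁ → IsOpen U₂ → IsOpen V₂ →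
    U₁.Nonempty → V₁.Nonempty → U₂.Nonempty → V₂.Nonempty →
    (nset T U₁ V₁ ∩ nset T U₂ V₂).Nonempty

theorem WM2.inter {X : Type*} [TopologicalSpace X] {T : X → X} (hT : Continuous T)
    (h : WM2 T) {A B : Set ℕ} (hA : A ∈ NTfam T) (hB : B ∈ NTfam T) : A ∩ B ∈ NTfam T := by
  obtain ⟨U₁, V₁, oU₁, oV₁, nU₁, nV₁, sA⟩ := hA
  obtain ⟨U₂, V₂, oU₂, oV₂, nU₂, nV₂, sB⟩ := hB
  obtain ⟨n, ⟨x, hx, hx'⟩, ⟨y, hy, hy'⟩⟩ := h U₁ U₂ V₁ V₂ oU₁ oU₂ oV₁ oV₂ nU₁ nU₂ nV₁ nV₂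
  refine ⟨U₁ ∩ T^[n] ⁻¹' U₂, V₁ ∩ T^[n] ⁻¹' V₂, oU₁.inter (oU₂.preimage (hT.iterate n)),
    oV₁.inter (oV₂.preimage (hT.iterate n)), ⟨x, hx, hx'⟩, ⟨y, hy, hy'⟩, ?_⟩
  rintro k ⟨z, ⟨hz, hz'⟩, ⟨hw, hw'⟩⟩
  refine ⟨sA ⟨z, hz, hw⟩, sB ⟨T^[n] z, hz', ?_⟩⟩
  have e : T^[k] (T^[n] z) = T^[n] (T^[k] z) := by
    rw [← iterate_add_apply, ← iterate_add_apply, add_comm]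
  rw [e]
  exact hw'

theorem NTfam_up {X : Type*} [TopologicalSpace X] {T : X → X} {A B : Set ℕ}
    (hA : A ∈ NTfam T) (hAB : A ⊆ B) : B ∈ NTfam T := by
  obtain ⟨U, V, a, b, c, d, e⟩ := hA
  exact ⟨U, V, a, b, c, d, e.trans hAB⟩

theorem WM2.trans {X : Type*} [TopologicalSpace X] {T : X → X} (h : WM2 T) {U V : Set X}
    (oU : IsOpen U) (oV : IsOpen V) (nU : U.Nonempty) (nV : V.Nonempty) :
    (nset T U V).Nonempty := by
  obtain ⟨n, hn, -⟩ := h U V U V oU oV oU oV nU nV nU nV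
  exact ⟨n, hn⟩

theorem WM2.pre_one {X : Type*} [MetricSpace X] {T : X → X} (h : WM2 T)
    (hX : ∃ x y : X, x ≠ y) {V : Set X} (oV : IsOpen V) (nV : V.Nonempty) :
    (T ⁻¹' V).Nonempty := by
  by_contra hne
  rw [not_nonempty_iff_eq_empty] at hne
  have key : ∀ U W : Set X, IsOpen U → U.Nonempty → IsOpen W → W.Nonempty → W ⊆ V →
      (W ∩ U).Nonempty := by
    intro U W oU nU oW nW hWV
    obtain ⟨n, x, hx, hx'⟩ := h.trans oU oW nU nW
    cases n with
    | zero => exact ⟨x, hx', hx⟩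
    | succ n =>
      rw [iterate_succ_apply'] at hx'
      have : T^[n] x ∈ T ⁻¹' V := hWV hx'
      rw [hne] at this
      exact this.elim
  obtain ⟨x, y, hxy⟩ := hX
  obtain ⟨U, W, oU, oW, hxU, hyW, hd⟩ := t2_separation hxy
  have h1 := key U V oU ⟨x, hxU⟩ oV nV subset_rfl
  obtain ⟨z, hz, hzW⟩ := key W (V ∩ U) oW ⟨y, hyW⟩ (oV.inter oU) h1 inter_subset_left
  exact Set.disjoint_left.1 hd hz.2 hzW

theorem WM2.pre {X : Type*} [MetricSpace X] {T : X → X} (hT : Continuous T) (h : WM2 T)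
    (hX : ∃ x y : X, x ≠ y) {V : Set X} (oV : IsOpen V) (nV : V.Nonempty) (i : ℕ) :
    (T^[i] ⁻¹' V).Nonempty := by
  induction i with
  | zero => exact nV
  | succ n ih =>
    obtain ⟨x, hx⟩ := h.pre_one hX (oV.preimage (hT.iterate n)) ih
    exact ⟨x, hx⟩

theorem WM2.shift_neg {X : Type*} [MetricSpace X] {T : X → X} (hT : Continuous T) (h : WM2 T)
    (hX : ∃ x y : X, x ≠ y) {A : Set ℕ} (hA : A ∈ NTfam T) (i : ℕ) :
    {n | n + i ∈ A} ∈ NTfam T := by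
  obtain ⟨U, V, oU, oV, nU, nV, s⟩ := hA
  refine ⟨U, T^[i] ⁻¹' V, oU, oV.preimage (hT.iterate i), nU, h.pre hT hX oV nV i, ?_⟩
  rintro n ⟨x, hx, hx'⟩
  refine s ⟨x, hx, ?_⟩
  rw [add_comm, iterate_add_apply]
  exact hx'

theorem NTfam_ne {X : Type*} [MetricSpace X] {T : X → X} (hT : Continuous T)
    (hX : ∃ x y : X, x ≠ y) (j : ℕ) : {n | n ≠ j} ∈ NTfam T := by
  obtain ⟨x, y, hxy⟩ := hX
  have : ∃ z, T^[j] x ≠ z := by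
    by_cases hx : T^[j] x = x
    · exact ⟨y, by rwa [hx]⟩
    · exact ⟨x, hx⟩
  obtain ⟨z, hz⟩ := this
  obtain ⟨U, W, oU, oW, hxU, hyW, hd⟩ := t2_separation hz
  refine ⟨T^[j] ⁻¹' U, W, oU.preimage (hT.iterate j), oW, ⟨x, hxU⟩, ⟨z, hyW⟩, ?_⟩
  rintro n ⟨w, hw, hw'⟩ rfl
  exact Set.disjoint_left.1 hd hw hw'

theorem WM2.ge {X : Type*} [MetricSpace X] {T : X → X} (hT : Continuous T) (h : WM2 T)
    (hX : ∃ x y : X, x ≠ y) (i : ℕ) : {n | i ≤ n} ∈ NTfam T := by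
  induction i with
  | zero => exact NTfam_up (NTfam_ne hT hX 0) (fun n _ => Nat.zero_le n)
  | succ i ih =>
    refine NTfam_up (h.inter hT ih (NTfam_ne hT hX i)) ?_
    rintro n ⟨h1, h2⟩
    simp only [mem_ofPred_eq] at *
    omega

theorem WM2.shift_pos {X : Type*} [MetricSpace X] {T : X → X} (hT : Continuous T) (h : WM2 T)
    (hX : ∃ x y : X, x ≠ y) {A : Set ℕ} (hA : A ∈ NTfam T) (i : ℕ) :
    {n | ∃ m ∈ A, n = m + i} ∈ NTfam T := by
  obtain ⟨U, V, oU, oV, nU, nV, s⟩ := hA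
  have h1 : nset T (T^[i] ⁻¹' U) V ∈ NTfam T :=
    ⟨_, _, oU.preimage (hT.iterate i), oV, h.pre hT hX oU nU i, nV, subset_rfl⟩
  refine NTfam_up (h.inter hT h1 (h.ge hT hX i)) ?_
  rintro n ⟨⟨x, hx, hx'⟩, hn⟩
  obtain ⟨m, rfl⟩ := Nat.exists_eq_add_of_le (show i ≤ n from hn)
  refine ⟨m, s ⟨T^[i] x, hx, ?_⟩, add_comm _ _⟩
  rw [← iterate_add_apply, add_comm]
  exact hx'

theorem WM2.of_thick {X : Type*} [TopologicalSpace X] {T : X → X} (hT : Continuous T)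
    (he : ∅ ∉ NTfam T) (ht : ThickFamily (NTfam T)) : WM2 T := by
  have ne : ∀ A ∈ NTfam T, A.Nonempty := by
    intro A hA
    rw [nonempty_iff_ne_empty]
    rintro rfl
    exact he hA
  intro U₁ V₁ U₂ V₂ oU₁ oV₁ oU₂ oV₂ nU₁ nV₁ nU₂ nV₂
  obtain ⟨m, x, hx, hx'⟩ := ne (nset T U₁ U₂) ⟨_, _, oU₁, oU₂, nU₁, nU₂, subset_rfl⟩
  obtain ⟨k, y, hy, hy'⟩ := ne (nset T V₁ V₂) ⟨_, _, oV₁, oV₂, nV₁, nV₂, subset_rfl⟩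
  obtain ⟨n, hn⟩ := ne _ (ht (nset T (U₁ ∩ T^[m] ⁻¹' U₂) (V₁ ∩ T^[k] ⁻¹' V₂))
    ⟨_, _, oU₁.inter (oU₂.preimage (hT.iterate m)), oV₁.inter (oV₂.preimage (hT.iterate k)),
      ⟨x, hx, hx'⟩, ⟨y, hy, hy'⟩, subset_rfl⟩ (k + m))
  obtain ⟨a, ha, ha'⟩ := hn k (by omega)
  obtain ⟨b, hb, hbq⟩ := hn m (by omega)
  refine ⟨n + k, ⟨a, ha.1, ha'.1⟩, ⟨T^[m] b, hb.2, ?_⟩⟩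
  have e : T^[n + k] (T^[m] b) = T^[k] (T^[n + m] b) := by
    rw [← iterate_add_apply, ← iterate_add_apply, show n + k + m = k + (n + m) by omega]
  rw [e]
  exact hbq.2

/-- Let `F` be a Furstenberg family and `(X,T)` a topological dynamical
system where `X` is not a singleton. Then `T` is `F`-mixing iff the family `N_T`
generated by the return time sets is a shift-invariant thick subfamily of `F`
(in particular it is a Furstenberg family, so `∅ ∉ N_T`, and `N_T ⊆ F`). -/
theorem fMixing_iff_NTfam_shiftInvariant_thick_subfamily
    {X : Type*} [MetricSpace X] (T : X → X) (hT : Continuous T)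
    (hX : ∃ x y : X, x ≠ y) (F : Set (Set ℕ)) (hF : IsFamily F) :
    FMix T F ↔
      (IsFamily (NTfam T) ∧ NTfam T ⊆ F ∧ ShiftInvariant (NTfam T) ∧
        ThickFamily (NTfam T)) := by
  constructor
  · intro hM
    have hmem : ∀ U₁ V₁ U₂ V₂ : Set X, IsOpen U₁ → IsOpen V₁ → IsOpen U₂ → IsOpen V₂ →
        U₁.Nonempty → V₁.Nonempty → U₂.Nonempty → V₂.Nonempty →
        nset T U₁ V₁ ∩ nset T U₂ V₂ ∈ F := by
      intro U₁ V₁ U₂ V₂ oU₁ oV₁ oU₂ oV₂ nU₁ nV₁ nU₂ nV₂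
      rw [← nset_prod']
      exact hM _ _ (oU₁.prod oU₂) (oV₁.prod oV₂) (nU₁.prod nU₂) (nV₁.prod nV₂)
    have h : WM2 T := by
      intro U₁ V₁ U₂ V₂ oU₁ oV₁ oU₂ oV₂ nU₁ nV₁ nU₂ nV₂
      have := hmem U₁ V₁ U₂ V₂ oU₁ oV₁ oU₂ oV₂ nU₁ nV₁ nU₂ nV₂
      rw [nonempty_iff_ne_empty]
      intro h0
      rw [h0] at this
      exact hF.2.2 this
    refine ⟨⟨⟨_, NTfam_ne hT hX 0⟩, fun A B => NTfam_up, ?_⟩, ?_, ?_, ?_⟩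
    · rintro ⟨U, V, oU, oV, nU, nV, s⟩
      obtain ⟨n, hn⟩ := h.trans oU oV nU nV
      exact s hn
    · rintro A ⟨U, V, oU, oV, nU, nV, s⟩
      exact hF.2.1 (hmem U V U V oU oV oU oV nU nV nU nV) (inter_subset_left.trans s)
    · intro A hA i
      obtain ⟨j, rfl | rfl⟩ := i.eq_nat_or_neg
      · refine NTfam_up (h.shift_pos hT hX hA j) ?_
        rintro n ⟨m, hm, rfl⟩
        exact ⟨m, hm, by push_cast; rfl⟩
      · refine NTfam_up (h.shift_neg hT hX hA j) ?_
        intro n hn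
        exact ⟨n + j, hn, by push_cast; ring⟩
    · intro A hA k
      induction k with
      | zero =>
        refine NTfam_up hA ?_
        intro n hn i hi
        obtain rfl : i = 0 := by omega
        exact hn
      | succ k ih =>
        refine NTfam_up (h.inter hT ih (h.shift_neg hT hX hA (k + 1))) ?_
        rintro n ⟨h1, h2⟩ i hi
        rcases Nat.lt_or_ge k i with hk | hk
        · obtain rfl : i = k + 1 := by omega
          exact h2
        · exact h1 i hk
  · rintro ⟨hfam, hsub, -, ht⟩
    have h : WM2 T := WM2.of_thick hT hfam.2.2 ht
    intro U V oU oV nU nV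
    obtain ⟨⟨a, b⟩, hab⟩ := nU
    obtain ⟨⟨c, d⟩, hcd⟩ := nV
    obtain ⟨U₁, U₂, oU₁, oU₂, haU, hbU, sU⟩ := isOpen_prod_iff.1 oU a b hab
    obtain ⟨V₁, V₂, oV₁, oV₂, hcV, hdV, sV⟩ := isOpen_prod_iff.1 oV c d hcd
    refine hF.2.1 (hsub ?_) (nset_mono' sU sV)
    rw [nset_prod']
    exact h.inter hT ⟨_, _, oU₁, oV₁, ⟨a, haU⟩, ⟨c, hcV⟩, subset_rfl⟩
      ⟨_, _, oU₂, oV₂, ⟨b, hbU⟩, ⟨d, hdV⟩, subset_rfl⟩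
end

section
/- Let X = c₀(ℕ) or ℓ^p(ℕ) with 1 ≤ p < ∞. There exists a bounded sequence w = (w_n)_{n≥1} of positive real numbers such that, for the weighted backward shift B_w : X → X defined by (B_w x)_n = w_{n+1} x_{n+1}, the direct sum B_w ⊕ B_w² is weakly mixing but B_w ⊕ B_w³ is not hypercyclic. -/
open Set Topology Function Filter
open scoped ENNReal

/-- The set where the weight products may be large. -/
def bumpSet : Set ℕ :=
  {n | ∃ k : ℕ, (9 * 10 ^ k < 10 * n ∧ 10 * n < 11 * 10 ^ k) ∨
    (18 * 10 ^ k < 10 * n ∧ 10 * n < 22 * 10 ^ k)}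

/-- The weight products. -/
noncomputable def bumpW (n : ℕ) : ℝ := (2 : ℝ) ^ (Metric.infDist n bumpSetᶜ)

/-- The weights. -/
noncomputable def bumpw (n : ℕ) : ℝ := bumpW n / bumpW (n - 1)

lemma bumpSet_disj (n : ℕ) (h1 : n ∈ bumpSet) (h3 : 3 * n ∈ bumpSet) : False := by
  obtain ⟨k, hk⟩ := h1
  obtain ⟨l, hl⟩ := h3
  have hkp : 0 < 10 ^ k := by positivity
  have hlp : 0 < 10 ^ l := by positivity
  rcases lt_trichotomy k l with h | h | h
  · obtain ⟨d, rfl⟩ := Nat.exists_eq_add_of_lt h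
    have : 10 ^ (k + d + 1) = 10 * (10 ^ k * 10 ^ d) := by ring
    have h1 : 10 ^ k * 1 ≤ 10 ^ k * 10 ^ d := Nat.mul_le_mul_left _ (Nat.one_le_pow _ _ (by norm_num))
    rw [this] at hl
    generalize 10 ^ k * 10 ^ d = b at *
    omega
  · subst h
    omega
  · obtain ⟨d, rfl⟩ := Nat.exists_eq_add_of_lt h
    have : 10 ^ (l + d + 1) = 10 * (10 ^ l * 10 ^ d) := by ring
    have h1 : 10 ^ l * 1 ≤ 10 ^ l * 10 ^ d := Nat.mul_le_mul_left _ (Nat.one_le_pow _ _ (by norm_num))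
    rw [this] at hk
    generalize 10 ^ l * 10 ^ d = b at *
    omega

lemma bumpW_pos (n : ℕ) : 0 < bumpW n := by unfold bumpW; positivity

lemma bumpW_of_notMem {n : ℕ} (h : n ∉ bumpSet) : bumpW n = 1 := by
  unfold bumpW
  rw [Metric.infDist_zero_of_mem (by exact h)]; simp

lemma zero_notMem : 0 ∉ bumpSet := by
  rintro ⟨k, hk⟩
  omega

lemma bumpW_zero : bumpW 0 = 1 := bumpW_of_notMem zero_notMem

lemma bumpW_min (n : ℕ) : bumpW n = 1 ∨ bumpW (3 * n) = 1 := by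
  by_cases h : n ∈ bumpSet
  · right
    exact bumpW_of_notMem fun h3 => bumpSet_disj n h h3
  · left
    exact bumpW_of_notMem h

lemma bumpw_pos (n : ℕ) : 0 < bumpw n := div_pos (bumpW_pos _) (bumpW_pos _)

lemma bumpw_le (n : ℕ) : bumpw n ≤ 2 := by
  unfold bumpw
  rw [div_le_iff₀ (bumpW_pos _)]
  unfold bumpW
  have h := Metric.infDist_le_infDist_add_dist (s := bumpSetᶜ) (x := n) (y := n - 1)
  have h2 : dist n (n - 1) ≤ 1 := by
    rw [Nat.dist_eq, abs_le]
    rcases n with _ | n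
    · simp
    · simp
  have : (2 : ℝ) * 2 ^ Metric.infDist (n - 1) bumpSetᶜ = 2 ^ (Metric.infDist (n - 1) bumpSetᶜ + 1) := by
    rw [Real.rpow_add_one (by norm_num)]; ring
  rw [this]
  exact Real.rpow_le_rpow_of_exponent_le (by norm_num) (by linarith)

lemma bumpW_big (N : ℕ) (K : ℕ) : ∃ n, N ≤ n ∧ ∀ j ≤ N, (K : ℝ) ≤ bumpW (n + j) ∧
    (K : ℝ) ≤ bumpW (2 * n + j) := by
  obtain ⟨k, hk⟩ : ∃ k : ℕ, 10 * (N + K) < 10 ^ k := ⟨_, Nat.lt_pow_self (by norm_num)⟩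
  have key : ∀ m, (∀ y ∉ bumpSet, (K : ℝ) ≤ dist m y) → (K : ℝ) ≤ bumpW m := by
    intro m hm
    have h1 : (K : ℝ) ≤ Metric.infDist m bumpSetᶜ :=
      (Metric.le_infDist ⟨0, zero_notMem⟩).2 fun y hy => hm y hy
    have h2 : (K : ℝ) ≤ (2 : ℝ) ^ (K : ℝ) := by
      rw [Real.rpow_natCast]
      exact_mod_cast (Nat.lt_two_pow_self (n := K)).le
    exact h2.trans (Real.rpow_le_rpow_of_exponent_le (by norm_num) h1)
  refine ⟨10 ^ k, by omega, fun j hj => ⟨key _ ?_, key _ ?_⟩⟩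
  all_goals
    intro y hy
    by_contra hlt
    push Not at hlt
    rw [Nat.dist_eq, abs_lt] at hlt
    obtain ⟨h1, h2⟩ := hlt
    push_cast at h1 h2
    have h1' : (y : ℝ) < ((10 ^ k + 10 ^ k + j + K : ℕ) : ℝ) := by
      push_cast
      have : (0 : ℝ) < 10 ^ k := by positivity
      linarith
    apply hy
    refine ⟨k, ?_⟩
    generalize hb : 10 ^ k = b at *
    have hb' : (10 : ℝ) ^ k = b := by rw [← hb]; push_cast; rfl
    rw [hb'] at h1 h2
    norm_cast at h1' 
    first
    | have h3 : y < b + j + K := by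
        have : (y : ℝ) < ((b + j + K : ℕ) : ℝ) := by push_cast; linarith
        exact_mod_cast this
      have h4 : b + j < y + K := by
        have : ((b + j : ℕ) : ℝ) < ((y + K : ℕ) : ℝ) := by push_cast; linarith
        exact_mod_cast this
      omega
    | have h3 : y < 2 * b + j + K := by
        have : (y : ℝ) < ((2 * b + j + K : ℕ) : ℝ) := by push_cast; linarith
        exact_mod_cast this
      have h4 : 2 * b + j < y + K := by
        have : ((2 * b + j : ℕ) : ℝ) < ((y + K : ℕ) : ℝ) := by push_cast; linarith
        exact_mod_cast this
      omega

lemma prodMap'_iterate {X Y : Type*} (T : X → X) (S : Y → Y) (n : ℕ) (p : X × Y) :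
    (prodMap' T S)^[n] p = (T^[n] p.1, S^[n] p.2) := by
  induction n generalizing p with
  | zero => rfl
  | succ n ih => rw [iterate_succ_apply, ih]; rfl

section Abstract

variable {𝕜 X : Type*} [RCLike 𝕜] [NormedAddCommGroup X] [NormedSpace 𝕜 X]
  (coord : X →ₗ[𝕜] (ℕ → 𝕜)) (B : X →L[𝕜] X)

lemma coord_iterate
    (hB : ∀ x n, coord (B x) n = (bumpw (n + 1) : 𝕜) * coord x (n + 1)) (n : ℕ) (x : X) (j : ℕ) :
    coord (B^[n] x) j = ((bumpW (n + j) / bumpW j : ℝ) : 𝕜) * coord x (n + j) := by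
  induction n generalizing x j with
  | zero => simp [(bumpW_pos j).ne']
  | succ n ih =>
    rw [iterate_succ_apply, ih, hB, ← mul_assoc, ← RCLike.ofReal_mul]
    have : n + 1 + j = n + j + 1 := by omega
    rw [this]
    congr 2
    unfold bumpw
    have h1 := (bumpW_pos j).ne'
    have h2 := (bumpW_pos (n + j)).ne'
    simp only [Nat.add_sub_cancel]
    field_simp

lemma abstract_not_hyp
    (hB : ∀ x n, coord (B x) n = (bumpw (n + 1) : 𝕜) * coord x (n + 1))
    (hn : ∀ x n, ‖coord x n‖ ≤ ‖x‖)
    (e : ℕ → X) (he : ∀ i, coord (e i) = Pi.single i 1) :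
    ¬ HypercyclicMap (prodMap' ⇑B ((⇑B)^[3])) := by
  rintro ⟨⟨a, b⟩, hd⟩
  set R : ℝ := ‖a‖ + ‖b‖ + 2 with hR
  have hR0 : 0 ≤ R := by positivity
  obtain ⟨_, ⟨n, rfl⟩, hy⟩ := hd.exists_dist_lt (((R : 𝕜) • e 0, (R : 𝕜) • e 0) : X × X)
    (ε := 1) one_pos
  have key : ∀ (m : ℕ) (c : X), bumpW m = 1 → dist ((R : 𝕜) • e 0) (B^[m] c) < 1 → R < ‖c‖ + 1 := by
    intro m c hm hlt
    rw [dist_eq_norm] at hlt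
    have h1 := (hn _ 0).trans_lt hlt
    rw [map_sub, map_smul, he] at h1
    simp only [Pi.sub_apply, Pi.smul_apply, Pi.single_eq_same, coord_iterate coord B hB,
      Nat.add_zero, hm, bumpW_zero] at h1
    simp only [div_one, RCLike.ofReal_one, one_mul, smul_eq_mul, mul_one] at h1
    have h2 := norm_sub_norm_le (R : 𝕜) (coord c m)
    rw [RCLike.norm_ofReal, abs_of_nonneg hR0] at h2
    linarith [hn c m]
  simp only [prodMap'_iterate, ← iterate_mul, Prod.dist_eq, max_lt_iff] at hy
  have := norm_nonneg a
  have := norm_nonneg b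
  rcases bumpW_min n with h | h
  · linarith [key _ _ h hy.1]
  · linarith [key _ _ h hy.2]

lemma span_kill
    (hB : ∀ x n, coord (B x) n = (bumpw (n + 1) : 𝕜) * coord x (n + 1))
    (hinj : Injective coord)
    (e : ℕ → X) (he : ∀ i, coord (e i) = Pi.single i 1) (x : X)
    (hx : x ∈ Submodule.span 𝕜 (range e)) : ∃ N, ∀ n, N ≤ n → B^[n] x = 0 := by
  induction hx using Submodule.span_induction with
  | mem x h =>
    obtain ⟨i, rfl⟩ := h
    refine ⟨i + 1, fun n hn => hinj ?_⟩
    ext j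
    rw [coord_iterate coord B hB, he, Pi.single_eq_of_ne (by omega)]
    simp
  | zero => exact ⟨0, fun n _ => by simp⟩
  | add x y _ _ hx hy =>
    obtain ⟨N, hN⟩ := hx
    obtain ⟨M, hM⟩ := hy
    refine ⟨max N M, fun n hn => ?_⟩
    have h1 := hN n (le_trans (le_max_left _ _) hn)
    have h2 := hM n (le_trans (le_max_right _ _) hn)
    rw [iterate_map_add, h1, h2, add_zero]
  | smul a x _ hx =>
    obtain ⟨N, hN⟩ := hx
    refine ⟨N, fun n hn => ?_⟩
    have h1 := hN n hn
    rw [← FunLike.coe_pow_eq_iterate] at *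
    simp [h1]

lemma span_lift
    (hB : ∀ x n, coord (B x) n = (bumpw (n + 1) : 𝕜) * coord x (n + 1))
    (hinj : Injective coord)
    (e : ℕ → X) (he : ∀ i, coord (e i) = Pi.single i 1) (hen : ∀ i, ‖e i‖ ≤ 1) (x : X)
    (hx : x ∈ Submodule.span 𝕜 (range e)) : ∃ (N : ℕ) (C : ℝ), ∀ (n : ℕ) (K : ℝ), 0 < K →
      (∀ j ≤ N, K ≤ bumpW (n + j)) → ∃ z, B^[n] z = x ∧ ‖z‖ ≤ C / K := by
  induction hx using Submodule.span_induction with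
  | mem x h =>
    obtain ⟨i, rfl⟩ := h
    refine ⟨i, bumpW i, fun n K hK h =>
      ⟨((bumpW i / bumpW (n + i) : ℝ) : 𝕜) • e (n + i), hinj ?_, ?_⟩⟩
    · ext j
      rw [coord_iterate coord B hB, map_smul, he, he]
      by_cases hj : j = i
      · subst hj
        have h1 := (bumpW_pos j).ne'
        have h2 := (bumpW_pos (n + j)).ne'
        simp only [Pi.smul_apply, Pi.single_eq_same, smul_eq_mul, mul_one]
        rw [← RCLike.ofReal_mul]
        have : bumpW (n + j) / bumpW j * (bumpW j / bumpW (n + j)) = 1 := by field_simp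
        rw [this]; simp
      · rw [Pi.smul_apply, Pi.single_eq_of_ne hj, Pi.single_eq_of_ne (by omega)]; simp
    · have hp : 0 < bumpW i / bumpW (n + i) := div_pos (bumpW_pos _) (bumpW_pos _)
      rw [norm_smul, RCLike.norm_ofReal, abs_of_pos hp]
      calc _ ≤ bumpW i / bumpW (n + i) * 1 := by gcongr; exact hen _
        _ = bumpW i / bumpW (n + i) := mul_one _
        _ ≤ _ := by
          have := (bumpW_pos i).le
          have := h i le_rfl
          gcongr
  | zero => exact ⟨0, 0, fun n K hK _ => ⟨0, by simp, by simp⟩⟩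
  | add x y _ _ hx hy =>
    obtain ⟨N, C, hN⟩ := hx
    obtain ⟨M, D, hM⟩ := hy
    refine ⟨max N M, C + D, fun n K hK h => ?_⟩
    obtain ⟨z, hz, hzn⟩ := hN n K hK fun j hj => h j (hj.trans (le_max_left _ _))
    obtain ⟨z', hz', hzn'⟩ := hM n K hK fun j hj => h j (hj.trans (le_max_right _ _))
    refine ⟨z + z', ?_, ?_⟩
    · rw [iterate_map_add, hz, hz']
    · rw [add_div]
      exact (norm_add_le _ _).trans (add_le_add hzn hzn')
  | smul a x _ hx =>
    obtain ⟨N, C, hN⟩ := hx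
    refine ⟨N, ‖a‖ * C, fun n K hK h => ?_⟩
    obtain ⟨z, hz, hzn⟩ := hN n K hK h
    refine ⟨a • z, ?_, ?_⟩
    · rw [← FunLike.coe_pow_eq_iterate] at *
      simp [hz]
    · rw [norm_smul, mul_div_assoc]
      gcongr

lemma abstract_wmix
    (hB : ∀ x n, coord (B x) n = (bumpw (n + 1) : 𝕜) * coord x (n + 1))
    (hinj : Injective coord)
    (e : ℕ → X) (he : ∀ i, coord (e i) = Pi.single i 1) (hen : ∀ i, ‖e i‖ ≤ 1)
    (hdense : Dense (Submodule.span 𝕜 (range e) : Set X)) :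
    WMix (prodMap' ⇑B ((⇑B)^[2])) := by
  intro U V hU hV hUn hVn
  set D : Set X := (Submodule.span 𝕜 (range e) : Set X) with hD
  have hDD : Dense ((D ×ˢ D) ×ˢ (D ×ˢ D)) := (hdense.prod hdense).prod (hdense.prod hdense)
  obtain ⟨⟨⟨u1, u2⟩, ⟨u3, u4⟩⟩, ⟨⟨hu1, hu2⟩, ⟨hu3, hu4⟩⟩, huU⟩ := hDD.exists_mem_open hU hUn
  obtain ⟨⟨⟨v1, v2⟩, ⟨v3, v4⟩⟩, ⟨⟨hv1, hv2⟩, ⟨hv3, hv4⟩⟩, hvV⟩ := hDD.exists_mem_open hV hVn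
  obtain ⟨ε, hε, hball⟩ := Metric.isOpen_iff.1 hU _ huU
  have A : ∀ u ∈ D, ∀ v ∈ D, ∃ N : ℕ, ∀ (K : ℕ) (n : ℕ), N ≤ n → N ≤ K →
      (∀ j ≤ N, (K : ℝ) ≤ bumpW (n + j)) → ∃ x, dist x u < ε ∧ B^[n] x = v := by
    intro u hu v hv
    obtain ⟨N1, h1⟩ := span_kill coord B hB hinj e he u hu
    obtain ⟨N2, C, h2⟩ := span_lift coord B hB hinj e he hen v hv
    obtain ⟨N3, h3⟩ := exists_nat_gt (C / ε)
    refine ⟨max (max N1 N2) (max N3 1), fun K n hn hK h => ?_⟩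
    have hK0 : (0 : ℝ) < K := by
      have : 0 < K := by omega
      exact_mod_cast this
    obtain ⟨z, hz, hzn⟩ := h2 n K hK0 fun j hj => h j (by omega)
    refine ⟨u + z, ?_, ?_⟩
    · rw [dist_eq_norm, add_sub_cancel_left]
      refine hzn.trans_lt ?_
      rw [div_lt_iff₀ hK0]
      rw [div_lt_iff₀ hε] at h3
      have : (N3 : ℝ) ≤ K := by
        have : N3 ≤ K := by omega
        exact_mod_cast this
      nlinarith
    · have := h1 n (by omega)
      rw [iterate_map_add, this, hz, zero_add]
  obtain ⟨N1, h1⟩ := A u1 hu1 v1 hv1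
  obtain ⟨N2, h2⟩ := A u2 hu2 v2 hv2
  obtain ⟨N3, h3⟩ := A u3 hu3 v3 hv3
  obtain ⟨N4, h4⟩ := A u4 hu4 v4 hv4
  obtain ⟨N, hN⟩ : ∃ N, N = N1 + N2 + N3 + N4 := ⟨_, rfl⟩
  obtain ⟨n, hn, hW⟩ := bumpW_big N N
  obtain ⟨x1, hx1, hy1⟩ := h1 N n (by omega) (by omega) fun j hj => (hW j (by omega)).1
  obtain ⟨x2, hx2, hy2⟩ := h2 N (2 * n) (by omega) (by omega) fun j hj => (hW j (by omega)).2
  obtain ⟨x3, hx3, hy3⟩ := h3 N n (by omega) (by omega) fun j hj => (hW j (by omega)).1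
  obtain ⟨x4, hx4, hy4⟩ := h4 N (2 * n) (by omega) (by omega) fun j hj => (hW j (by omega)).2
  refine ⟨n, ((x1, x2), (x3, x4)), hball ?_, ?_⟩
  · simp only [Metric.mem_ball, Prod.dist_eq, max_lt_iff]
    exact ⟨⟨hx1, hx2⟩, hx3, hx4⟩
  · simp only [prodMap'_iterate, ← iterate_mul, hy1, hy2, hy3, hy4]
    exact hvV

end Abstract

section Lp

variable {𝕜 : Type} [RCLike 𝕜] {p : ℝ≥0∞} [Fact (1 ≤ p)]

lemma lp_bound (hp : 0 < p.toReal) (x : lp (fun _ : ℕ => 𝕜) p) (s : Finset ℕ) :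
    ∑ i ∈ s, ‖bumpw (i + 1) • x (i + 1)‖ ^ p.toReal ≤ (2 * ‖x‖) ^ p.toReal := by
  rw [Real.mul_rpow (by norm_num) (norm_nonneg _)]
  have h := lp.sum_rpow_le_norm_rpow hp x (s.map ⟨Nat.succ, Nat.succ_injective⟩)
  rw [Finset.sum_map] at h
  refine le_trans ?_ (mul_le_mul_of_nonneg_left h (by positivity))
  rw [Finset.mul_sum]
  refine Finset.sum_le_sum fun i _ => ?_
  rw [← Real.mul_rpow (by norm_num) (norm_nonneg _), norm_smul, Real.norm_of_nonneg (bumpw_pos _).le]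
  have := bumpw_le (i + 1)
  have h0 := (bumpw_pos (i + 1)).le
  refine Real.rpow_le_rpow (by positivity) ?_ hp.le
  exact mul_le_mul_of_nonneg_right this (norm_nonneg _)

/-- The shift on `ℓᵖ`. -/
noncomputable def lpShift (hp : 0 < p.toReal) :
    lp (fun _ : ℕ => 𝕜) p →L[𝕜] lp (fun _ : ℕ => 𝕜) p :=
  LinearMap.mkContinuous
    { toFun := fun x => ⟨fun i => bumpw (i + 1) • x (i + 1), memℓp_gen' (lp_bound hp x)⟩
      map_add' := fun x y => by
        ext i
        exact smul_add _ _ _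
      map_smul' := fun a x => by
        ext i
        exact smul_comm (bumpw (i + 1)) a (x (i + 1)) } 2
    (fun x => lp.norm_le_of_forall_sum_le hp (by positivity) (lp_bound hp x))

/-- Coordinates on `ℓᵖ`. -/
def lpCoord : lp (fun _ : ℕ => 𝕜) p →ₗ[𝕜] (ℕ → 𝕜) where
  toFun x := x
  map_add' _ _ := rfl
  map_smul' _ _ := rfl

end Lp

section C0

open scoped ZeroAtInfty

variable {𝕜 : Type} [RCLike 𝕜]

lemma c0_norm_le {f : ZeroAtInftyContinuousMap ℕ 𝕜} {C : ℝ} (hC : 0 ≤ C) (h : ∀ n, ‖f n‖ ≤ C) :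
    ‖f‖ ≤ C := by
  rw [← ZeroAtInftyContinuousMap.norm_toBCF_eq_norm]
  exact (BoundedContinuousFunction.norm_le hC).2 h

lemma c0_apply_le (f : ZeroAtInftyContinuousMap ℕ 𝕜) (n : ℕ) : ‖f n‖ ≤ ‖f‖ := by
  rw [← ZeroAtInftyContinuousMap.norm_toBCF_eq_norm]
  exact BoundedContinuousFunction.norm_coe_le_norm f.toBCF n

lemma c0_tendsto (f : ZeroAtInftyContinuousMap ℕ 𝕜) : Tendsto f atTop (𝓝 0) := by
  have := f.zero_at_infty'
  rwa [cocompact_eq_atTop] at this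

/-- Elements of `c₀(ℕ)` from null sequences. -/
def mkC0 (f : ℕ → 𝕜) (h : Tendsto f atTop (𝓝 0)) : ZeroAtInftyContinuousMap ℕ 𝕜 where
  toFun := f
  continuous_toFun := continuous_of_discreteTopology
  zero_at_infty' := by rwa [cocompact_eq_atTop]

lemma mkC0_apply (f : ℕ → 𝕜) (h : Tendsto f atTop (𝓝 0)) (n : ℕ) : mkC0 f h n = f n := rfl

lemma c0_shift_tendsto (f : ZeroAtInftyContinuousMap ℕ 𝕜) :
    Tendsto (fun n => bumpw (n + 1) • f (n + 1)) atTop (𝓝 0) := by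
  have h := ((tendsto_add_atTop_iff_nat 1).2 (c0_tendsto f)).norm.const_mul 2
  refine squeeze_zero_norm (fun n => ?_) (by simpa using h)
  rw [norm_smul, Real.norm_of_nonneg (bumpw_pos _).le]
  exact mul_le_mul_of_nonneg_right (bumpw_le _) (norm_nonneg _)

/-- The shift on `c₀`. -/
noncomputable def c0Shift : ZeroAtInftyContinuousMap ℕ 𝕜 →L[𝕜] ZeroAtInftyContinuousMap ℕ 𝕜 :=
  LinearMap.mkContinuous
    { toFun := fun x => mkC0 _ (c0_shift_tendsto x)
      map_add' := fun x y => by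
        ext i
        simp [smul_add, mkC0_apply]
      map_smul' := fun a x => by
        ext i
        exact smul_comm (bumpw (i + 1)) a (x (i + 1)) } 2
    (fun x => by
      refine c0_norm_le (by positivity) fun n => ?_
      change ‖bumpw (n + 1) • x (n + 1)‖ ≤ _
      rw [norm_smul, Real.norm_of_nonneg (bumpw_pos _).le]
      exact mul_le_mul (bumpw_le _) (c0_apply_le _ _) (norm_nonneg _) (by norm_num))

/-- Coordinates on `c₀`. -/
def c0Coord : ZeroAtInftyContinuousMap ℕ 𝕜 →ₗ[𝕜] (ℕ → 𝕜) where
  toFun x := x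
  map_add' _ _ := rfl
  map_smul' _ _ := rfl

lemma c0_single_tendsto (i : ℕ) : Tendsto (Pi.single i (1 : 𝕜) : ℕ → 𝕜) atTop (𝓝 0) := by
  refine tendsto_const_nhds.congr' ?_
  filter_upwards [eventually_gt_atTop i] with n hn
  rw [Pi.single_eq_of_ne (by omega)]

/-- Unit vectors of `c₀`. -/
def c0e (i : ℕ) : ZeroAtInftyContinuousMap ℕ 𝕜 := mkC0 _ (c0_single_tendsto i)

lemma c0e_norm (i : ℕ) : ‖(c0e i : ZeroAtInftyContinuousMap ℕ 𝕜)‖ ≤ 1 := by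
  refine c0_norm_le (by norm_num) fun n => ?_
  rw [c0e, mkC0_apply]
  by_cases h : n = i
  · subst h; simp
  · simp [h]

lemma c0_dense :
    Dense (Submodule.span 𝕜 (range (c0e : ℕ → ZeroAtInftyContinuousMap ℕ 𝕜)) : Set (ZeroAtInftyContinuousMap ℕ 𝕜)) := by
  intro x
  rw [Metric.mem_closure_iff]
  intro ε hε
  obtain ⟨N, hN⟩ := Metric.tendsto_atTop.1 (c0_tendsto x) (ε / 2) (by positivity)
  refine ⟨∑ i ∈ Finset.range N, x i • c0e i, Submodule.sum_mem _ fun i _ =>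
    Submodule.smul_mem _ _ (Submodule.subset_span ⟨i, rfl⟩), ?_⟩
  rw [dist_eq_norm]
  refine lt_of_le_of_lt (c0_norm_le (C := ε / 2) (by positivity) fun n => ?_) (by linarith)
  have hs : (∑ i ∈ Finset.range N, x i • c0e i : ZeroAtInftyContinuousMap ℕ 𝕜) n
      = if n < N then x n else 0 := by
    change c0Coord _ n = _
    rw [map_sum, Finset.sum_apply]
    simp only [map_smul]
    change ∑ i ∈ Finset.range N, x i * (Pi.single i (1 : 𝕜) : ℕ → 𝕜) n = _
    simp [Pi.single_apply]
  rw [ZeroAtInftyContinuousMap.sub_apply, hs]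
  split_ifs with h
  · simp; positivity
  · have := hN n (by omega)
    rw [dist_zero_right] at this
    simpa using this.le

end C0

/-- On `X = c₀(ℕ)` or `ℓᵖ(ℕ)`, `1 ≤ p < ∞`, there is a bounded positive
weight sequence `w` such that, for the unilateral weighted backward shift `B_w`,
`B_w ⊕ B_w²` is weakly mixing while `B_w ⊕ B_w³` is not hypercyclic. -/
theorem exists_shift_square_weaklyMixing_cube_not_hypercyclic :
    (∀ (𝕜 : Type) [RCLike 𝕜] (p : ℝ≥0∞) [Fact (1 ≤ p)], p ≠ ∞ →
      ∃ w : ℕ → ℝ, (∀ n, 0 < w n) ∧ (∃ C : ℝ, ∀ n, w n ≤ C) ∧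
        ∃ B : lp (fun _ : ℕ => 𝕜) p →L[𝕜] lp (fun _ : ℕ => 𝕜) p,
          (∀ (x : lp (fun _ : ℕ => 𝕜) p) (n : ℕ), B x n = w (n + 1) • x (n + 1)) ∧
          WMix (prodMap' ⇑B ((⇑B)^[2])) ∧
          ¬ HypercyclicMap (prodMap' ⇑B ((⇑B)^[3]))) ∧
    (∀ (𝕜 : Type) [RCLike 𝕜],
      ∃ w : ℕ → ℝ, (∀ n, 0 < w n) ∧ (∃ C : ℝ, ∀ n, w n ≤ C) ∧
        ∃ B : ZeroAtInftyContinuousMap ℕ 𝕜 →L[𝕜] ZeroAtInftyContinuousMap ℕ 𝕜,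
          (∀ (x : ZeroAtInftyContinuousMap ℕ 𝕜) (n : ℕ), B x n = w (n + 1) • x (n + 1)) ∧
          WMix (prodMap' ⇑B ((⇑B)^[2])) ∧
          ¬ HypercyclicMap (prodMap' ⇑B ((⇑B)^[3]))) := by
  constructor
  · intro 𝕜 _ p _ hp
    have hp1 : (1 : ℝ≥0∞) ≤ p := Fact.out
    have hp0 : 0 < p := lt_of_lt_of_le one_pos hp1
    have hpr : 0 < p.toReal := ENNReal.toReal_pos hp0.ne' hp
    have hB : ∀ (x : lp (fun _ : ℕ => 𝕜) p) (n : ℕ), lpCoord (lpShift hpr x) n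
        = (bumpw (n + 1) : 𝕜) * lpCoord x (n + 1) := fun x n =>
      RCLike.real_smul_eq_coe_mul _ _
    have hinj : Injective (lpCoord : lp (fun _ : ℕ => 𝕜) p →ₗ[𝕜] (ℕ → 𝕜)) :=
      fun x y h => lp.ext h
    have he : ∀ i, lpCoord (lp.single p i (1 : 𝕜) : lp (fun _ : ℕ => 𝕜) p) = Pi.single i 1 :=
      fun i => by
        change ⇑(lp.single p i (1 : 𝕜) : lp (fun _ : ℕ => 𝕜) p) = _
        exact lp.coeFn_single _ _ _
    refine ⟨bumpw, bumpw_pos, ⟨2, bumpw_le⟩, lpShift hpr, fun x n => rfl, ?_, ?_⟩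
    · refine abstract_wmix lpCoord _ hB hinj _ he (fun i => ?_) ?_
      · rw [lp.norm_single hp0]; simp
      · intro x
        refine mem_closure_of_tendsto (lp.hasSum_single hp x) (Eventually.of_forall fun s => ?_)
        refine Submodule.sum_mem _ fun i _ => ?_
        have : (lp.single p i (x i) : lp (fun _ : ℕ => 𝕜) p) = x i • lp.single p i (1 : 𝕜) := by
          rw [← lp.single_smul]; simp
        rw [this]
        exact Submodule.smul_mem _ _ (Submodule.subset_span ⟨i, rfl⟩)
    · exact abstract_not_hyp lpCoord _ hB (fun x n => lp.norm_apply_le_norm hp0.ne' x n) _ he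
  · intro 𝕜 _
    have hB : ∀ (x : ZeroAtInftyContinuousMap ℕ 𝕜) (n : ℕ), c0Coord (c0Shift x) n
        = (bumpw (n + 1) : 𝕜) * c0Coord x (n + 1) := fun x n =>
      RCLike.real_smul_eq_coe_mul _ _
    have hinj : Injective (c0Coord : ZeroAtInftyContinuousMap ℕ 𝕜 →ₗ[𝕜] (ℕ → 𝕜)) :=
      fun x y h => DFunLike.coe_injective h
    have he : ∀ i, c0Coord (c0e i : ZeroAtInftyContinuousMap ℕ 𝕜) = Pi.single i 1 :=
      fun i => rfl
    exact ⟨bumpw, bumpw_pos, ⟨2, bumpw_le⟩, c0Shift, fun x n => rfl,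
      abstract_wmix c0Coord _ hB hinj _ he c0e_norm c0_dense,
      abstract_not_hyp c0Coord _ hB c0_apply_le _ he⟩
end
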